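/- Let Ω ∈ (0,1) be a quadratic irrational and ω = (1,Ω). Then ω satisfies a Diophantine condition with minimal exponent: there exists γ > 0 such that |⟨k,ω⟩| ≥ γ/|k|₁ for all k ∈ ℤ²∖{0}. Moreover, if the continued fraction of Ω is purely periodic, then liminf of γ_k as |k|₁ → ∞ equals γ* = min over primitive q of γ*_q, and γ* > 0. -/

import Mathlib

open Real Filter Matrix

noncomputable section

/-- Orbit of the Gauss map `g(x) = {1/x}` starting at `Ω`:
`x₀ = Ω`, `x_{j+1} = g(x_j)`. -/
def gaussOrbit (Ω : ℝ) : ℕ → ℝ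
  | 0 => Ω
  | j + 1 => Int.fract (1 / gaussOrbit Ω j)

/-- `cfA Ω j` is the partial quotient `a_{j+1}` of the continued fraction of `Ω`. -/
def cfA (Ω : ℝ) (j : ℕ) : ℤ := ⌊1 / gaussOrbit Ω j⌋

/-- The matrix `[[a, 1], [1, 0]]`. -/
def Acf (a : ℤ) : Matrix (Fin 2) (Fin 2) ℤ := !![a, 1; 1, 0]

/-- The product `A₁ ⋯ A_m` with `A_i = [[a_i, 1], [1, 0]]`. -/
def cfMatProd (Ω : ℝ) (m : ℕ) : Matrix (Fin 2) (Fin 2) ℤ :=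
  ((List.range m).map fun i => Acf (cfA Ω i)).prod

/-- `cfQ Ω (j+1) = q_j`:  `q₋₁ = 0`, `q₀ = 1`, `q_j = a_j q_{j-1} + q_{j-2}`. -/
def cfQ (Ω : ℝ) : ℕ → ℤ
  | 0 => 0
  | 1 => 1
  | j + 2 => cfA Ω j * cfQ Ω (j + 1) + cfQ Ω j

/-- `cfP Ω (j+1) = p_j`:  `p₋₁ = 1`, `p₀ = 0`, `p_j = a_j p_{j-1} + p_{j-2}`. -/
def cfP (Ω : ℝ) : ℕ → ℤ
  | 0 => 1
  | 1 => 0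
  | j + 2 => cfA Ω j * cfP Ω (j + 1) + cfP Ω j

/-- The vector convergent `w(j) = (q_j, p_j)`. -/
def wconv (Ω : ℝ) (j : ℕ) : Fin 2 → ℤ := ![cfQ Ω (j + 1), cfP Ω (j + 1)]

/-- The resonant convergent `v(j) = (−p_j, q_j)`. -/
def vconv (Ω : ℝ) (j : ℕ) : Fin 2 → ℤ := ![-cfP Ω (j + 1), cfQ Ω (j + 1)]

/-- A quadratic irrational number. -/
def IsQuadraticIrrational (Ω : ℝ) : Prop :=
  Irrational Ω ∧ ∃ A B C : ℤ, A ≠ 0 ∧ (A : ℝ) * Ω ^ 2 + (B : ℝ) * Ω + (C : ℝ) = 0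

end
noncomputable section

/-- `⟨k, ω⟩ = k₁ + k₂ Ω` for `ω = (1, Ω)`. -/
def pairω (Ω : ℝ) (k : Fin 2 → ℤ) : ℝ := (k 0 : ℝ) + (k 1 : ℝ) * Ω

/-- `|k|₁ = |k₁| + |k₂|`. -/
def norm1 (k : Fin 2 → ℤ) : ℤ := |k 0| + |k 1|

/-- `p⁰(q)`: the integer nearest to `qΩ`. -/
def p0 (Ω : ℝ) (q : ℤ) : ℤ := round ((q : ℝ) * Ω)

/-- `k⁰(q) = (−p⁰(q), q)`. -/
def kzero (Ω : ℝ) (q : ℤ) : Fin 2 → ℤ := ![-p0 Ω q, q]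

/-- The set `A` of quasi-resonances: vectors `k⁰(q)`, `q ≥ 1`, with `|⟨k,ω⟩| < 1/2`. -/
def inA (Ω : ℝ) (k : Fin 2 → ℤ) : Prop :=
  ∃ q : ℤ, 1 ≤ q ∧ k = kzero Ω q ∧ |pairω Ω k| < 1 / 2

/-- A quasi-resonance `k` is primitive if `U⁻¹k` is not a quasi-resonance. -/
def PrimitiveVec (Ω : ℝ) (U : Matrix (Fin 2) (Fin 2) ℤ) (k : Fin 2 → ℤ) : Prop :=
  inA Ω k ∧ ¬inA Ω (U⁻¹.mulVec k)

/-- A primitive integer `q ≥ 1`. -/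
def PrimitiveInt (Ω : ℝ) (U : Matrix (Fin 2) (Fin 2) ℤ) (q : ℤ) : Prop :=
  1 ≤ q ∧ PrimitiveVec Ω U (kzero Ω q)

/-- The resonant sequence `s(q, n) = Uⁿ k⁰(q)`. -/
def sres (Ω : ℝ) (U : Matrix (Fin 2) (Fin 2) ℤ) (q : ℤ) (n : ℕ) : Fin 2 → ℤ :=
  (U ^ n).mulVec (kzero Ω q)

/-- `U = σ (T⁻¹)ᵀ` with `σ = det T = (−1)^m` and `T = A₁⋯A_m`. -/
def Umat (Ω : ℝ) (m : ℕ) : Matrix (Fin 2) (Fin 2) ℤ :=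
  ((-1 : ℤ) ^ m) • ((cfMatProd Ω m)⁻¹)ᵀ

/-- The numerator `γ_k = |⟨k,ω⟩| · |k|₁`. -/
def gammaK (Ω : ℝ) (k : Fin 2 → ℤ) : ℝ := |pairω Ω k| * (norm1 k : ℝ)

/-- `K_q = |z_q|(1+Ω)/|c+bΩ²|`, where `z_q = cq + bpΩ`, `p = p⁰(q)`,
and `b, c` are the off-diagonal entries of `T = A₁⋯A_m = [[a,b],[c,d]]`. -/
def KqD (Ω : ℝ) (m : ℕ) (q : ℤ) : ℝ :=
  |(cfMatProd Ω m 1 0 : ℝ) * (q : ℝ) + (cfMatProd Ω m 0 1 : ℝ) * (p0 Ω q : ℝ) * Ω| * (1 + Ω) /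
    |(cfMatProd Ω m 1 0 : ℝ) + (cfMatProd Ω m 0 1 : ℝ) * Ω ^ 2|

/-- The limit numerator `γ*_q = |r_q| K_q` with `r_q = qΩ − p⁰(q)`. -/
def gammaStarQ (Ω : ℝ) (m : ℕ) (q : ℤ) : ℝ :=
  |(q : ℝ) * Ω - (p0 Ω q : ℝ)| * KqD Ω m q

end

lemma aux_orbit (Ω : ℝ) (h0 : 0 < Ω) (h1 : Ω < 1) (hirr : Irrational Ω) (j : ℕ) :
    Irrational (gaussOrbit Ω j) ∧ 0 < gaussOrbit Ω j ∧ gaussOrbit Ω j < 1 := by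
  induction j with
  | zero => exact ⟨hirr, h0, h1⟩
  | succ j ih =>
    have hi : Irrational (1 / gaussOrbit Ω j) := by
      rw [one_div]; exact ih.1.inv
    have hf : Irrational (Int.fract (1 / gaussOrbit Ω j)) := by
      rw [Int.fract]; exact hi.sub_intCast _
    refine ⟨hf, lt_of_le_of_ne (Int.fract_nonneg _) ?_, Int.fract_lt_one _⟩
    intro h
    exact hf.ne_zero h.symm

lemma aux_mat (Ω : ℝ) (h0 : 0 < Ω) (h1 : Ω < 1) (hirr : Irrational Ω) (j : ℕ) :
    ∃ a b c d : ℤ, cfMatProd Ω j = !![a, b; c, d] ∧ 1 ≤ a ∧ 0 ≤ b ∧ 0 ≤ c ∧ 0 ≤ d ∧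
      1 ≤ c + d ∧ a * d - b * c = (-1) ^ j ∧ (1 ≤ j → 1 ≤ b ∧ 1 ≤ c) ∧
      (c : ℝ) + d * gaussOrbit Ω j = (a + b * gaussOrbit Ω j) * Ω := by
  induction j with
  | zero =>
    refine ⟨1, 0, 0, 1, ?_, by simp, by simp, by simp, by simp, by simp, by simp, by simp, ?_⟩
    · simp [cfMatProd, Matrix.one_fin_two]
    · simp [gaussOrbit]
  | succ j ih =>
    obtain ⟨a, b, c, d, hT, ha, hb, hc, hd, hcd, hdet, -, heq⟩ := ih
    obtain ⟨-, hx0, hx1⟩ := aux_orbit Ω h0 h1 hirr j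
    have hα : 1 ≤ cfA Ω j := by
      rw [cfA, Int.le_floor]
      rw [le_div_iff₀ hx0]; push_cast; linarith
    have hx : 1 / gaussOrbit Ω j = (cfA Ω j : ℝ) + gaussOrbit Ω (j + 1) := by
      simp only [cfA, gaussOrbit]
      exact (Int.floor_add_fract _).symm
    have hstep : cfMatProd Ω (j + 1) = cfMatProd Ω j * Acf (cfA Ω j) := by
      simp [cfMatProd, List.range_succ]
    generalize cfA Ω j = α at hα hx hstep
    generalize gaussOrbit Ω (j + 1) = y at hx
    have hxy : ((α : ℝ) + y) * gaussOrbit Ω j = 1 := by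
      rw [← hx]; field_simp
    generalize gaussOrbit Ω j = x at *
    have haα : 1 ≤ a * α := by nlinarith
    have hcα : c ≤ c * α := by nlinarith
    refine ⟨a * α + b, a, c * α + d, c, ?_, by linarith, by linarith, by linarith, hc,
      by linarith, ?_, fun _ => ⟨ha, by linarith⟩, ?_⟩
    · rw [hstep, hT, Acf]
      ext i k; fin_cases i <;> fin_cases k <;> simp [Matrix.mul_apply, Fin.sum_univ_two]
    · rw [pow_succ, ← hdet]; ring
    · have hne : (α : ℝ) + y ≠ 0 := by
        intro h; rw [h] at hxy; simp at hxy
      push_cast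
      linear_combination ((α : ℝ) + y) * heq + (b * Ω - d) * hxy

/-- The integer quadratic form attached to a polynomial `A X² + B X + C`. -/
def qform (A B C : ℤ) (k : Fin 2 → ℤ) : ℤ := A * k 0 ^ 2 - B * k 0 * k 1 + C * k 1 ^ 2

lemma qform_fac (Ω : ℝ) (A B C : ℤ) (h : (A : ℝ) * Ω ^ 2 + B * Ω + C = 0) (k : Fin 2 → ℤ) :
    (qform A B C k : ℝ) = pairω Ω k * (A * k 0 - (A * Ω + B) * k 1) := by
  simp only [qform, pairω]; push_cast
  linear_combination (k 1 : ℝ) ^ 2 * h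

lemma aux_irr (Ω : ℝ) (hirr : Irrational Ω) (x y : ℤ) (h : (x : ℝ) + y * Ω = 0) :
    x = 0 ∧ y = 0 := by
  have hy : y = 0 := by
    by_contra hy
    refine hirr ⟨-(x : ℚ) / y, ?_⟩
    have : (y : ℝ) ≠ 0 := by exact_mod_cast hy
    push_cast
    field_simp
    linarith
  subst hy
  refine ⟨?_, rfl⟩
  simpa using h

lemma pair_ne (Ω : ℝ) (hirr : Irrational Ω) (k : Fin 2 → ℤ) (hk : k ≠ 0) : pairω Ω k ≠ 0 := by
  intro h
  obtain ⟨h0, h1⟩ := aux_irr Ω hirr _ _ h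
  apply hk
  ext i; fin_cases i
  · exact h0
  · exact h1

lemma qform_ge (Ω : ℝ) (hirr : Irrational Ω) (A B C : ℤ) (hA : A ≠ 0)
    (h : (A : ℝ) * Ω ^ 2 + B * Ω + C = 0) (k : Fin 2 → ℤ) (hk : k ≠ 0) :
    1 ≤ |qform A B C k| := by
  refine Int.one_le_abs ?_
  intro h0
  have h2 := qform_fac Ω A B C h k
  rw [h0] at h2
  have h3 : ((A * k 0 - B * k 1 : ℤ) : ℝ) + ((-A * k 1 : ℤ) : ℝ) * Ω = 0 := by
    have := (mul_eq_zero.mp (by simpa using h2.symm)).resolve_left (pair_ne Ω hirr k hk)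
    push_cast; linear_combination this
  obtain ⟨h4, h5⟩ := aux_irr Ω hirr _ _ h3
  have h6 : k 1 = 0 := by simpa [hA] using h5
  rw [h6] at h4
  have h7 : k 0 = 0 := by simpa [hA] using h4
  apply hk
  ext i; fin_cases i
  · exact h7
  · exact h6

lemma norm1_pos (k : Fin 2 → ℤ) (hk : k ≠ 0) : 0 < norm1 k := by
  have h0 := abs_nonneg (k 0)
  have h1 := abs_nonneg (k 1)
  rw [norm1]
  by_contra hc
  have h2 : k 0 = 0 := abs_eq_zero.mp (by omega)
  have h3 : k 1 = 0 := abs_eq_zero.mp (by omega)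
  apply hk
  ext i; fin_cases i
  · exact h2
  · exact h3

lemma aux_dioph (Ω : ℝ) (hquad : IsQuadraticIrrational Ω) :
    ∃ γ : ℝ, 0 < γ ∧ ∀ k : Fin 2 → ℤ, k ≠ 0 → γ / (norm1 k : ℝ) ≤ |pairω Ω k| := by
  obtain ⟨hirr, A, B, C, hA, h⟩ := hquad
  have hApos : 0 < |(A : ℝ)| := abs_pos.mpr (by exact_mod_cast hA)
  have hM : 0 < |(A : ℝ)| + |A * Ω + B| := by positivity
  refine ⟨1 / (|(A : ℝ)| + |A * Ω + B|), by positivity, fun k hk => ?_⟩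
  have hn : (0 : ℝ) < norm1 k := by exact_mod_cast norm1_pos k hk
  have h1 : (1 : ℝ) ≤ |(qform A B C k : ℝ)| := by
    exact_mod_cast qform_ge Ω hirr A B C hA h k hk
  rw [qform_fac Ω A B C h, abs_mul] at h1
  have h2 : |(A : ℝ) * k 0 - (A * Ω + B) * k 1| ≤ (|(A : ℝ)| + |A * Ω + B|) * norm1 k := by
    refine (abs_sub _ _).trans ?_
    rw [abs_mul, abs_mul, norm1]
    push_cast
    nlinarith [abs_nonneg (k 0 : ℝ), abs_nonneg (k 1 : ℝ), abs_nonneg (A : ℝ),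
      abs_nonneg (A * Ω + B), mul_nonneg (abs_nonneg (A : ℝ)) (abs_nonneg (k 1 : ℝ)),
      mul_nonneg (abs_nonneg (A * Ω + B)) (abs_nonneg (k 0 : ℝ))]
  rw [div_div, div_le_iff₀ (by positivity)]
  exact h1.trans (mul_le_mul_of_nonneg_left h2 (abs_nonneg _))

lemma inA_of (Ω : ℝ) (k : Fin 2 → ℤ) (h1 : 1 ≤ k 1) (h2 : |pairω Ω k| < 1 / 2) : inA Ω k := by
  refine ⟨k 1, h1, ?_, h2⟩
  have h3 := abs_sub_round ((k 1 : ℝ) * Ω)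
  have h4 : |((k 0 + round ((k 1 : ℝ) * Ω) : ℤ) : ℝ)| < 1 := by
    push_cast
    rw [pairω, abs_lt] at h2
    rw [abs_le] at h3
    rw [abs_lt]
    constructor <;> linarith
  have h5 : |k 0 + round ((k 1 : ℝ) * Ω)| < 1 := by exact_mod_cast h4
  rw [Int.abs_lt_one_iff] at h5
  ext i; fin_cases i
  · simp [kzero, p0]; omega
  · simp [kzero]

lemma inA_ne (Ω : ℝ) (k : Fin 2 → ℤ) (h : inA Ω k) : k ≠ 0 := by
  rintro rfl
  obtain ⟨q, hq, h, -⟩ := h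
  have := congrFun h 1
  simp [kzero] at this
  omega

lemma inA_one (Ω : ℝ) (hirr : Irrational Ω) : inA Ω (kzero Ω 1) := by
  refine ⟨1, le_rfl, rfl, ?_⟩
  have h3 := abs_sub_round ((1 : ℤ) * Ω : ℝ)
  have he : pairω Ω (kzero Ω 1) = (1 : ℤ) * Ω - round ((1 : ℤ) * Ω : ℝ) := by
    simp [pairω, kzero, p0]; ring
  rw [he]
  refine lt_of_le_of_ne h3 fun h => ?_
  generalize round ((1 : ℤ) * Ω : ℝ) = p at h
  rcases (abs_eq (by norm_num)).mp h with h | h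
  · have := (aux_irr Ω hirr (-2 * p - 1) 2 (by push_cast at h ⊢; linarith)).2
    omega
  · have := (aux_irr Ω hirr (-2 * p + 1) 2 (by push_cast at h ⊢; linarith)).2
    omega

lemma liminf_aux {ι : Type*} (u : ι → ℝ) (l : Filter ι) (g : ℝ)
    (h1 : ∀ ε > 0, ∀ᶠ x in l, g - ε ≤ u x) (h2 : ∀ ε > 0, ∃ᶠ x in l, u x ≤ g + ε) :
    Filter.liminf u l = g := by
  rw [liminf_eq]
  refine IsLUB.csSup_eq ⟨?_, ?_⟩ ⟨g - 1, h1 1 one_pos⟩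
  · intro a ha
    refine le_of_forall_pos_le_add fun ε hε => ?_
    obtain ⟨x, hx1, hx2⟩ := ((h2 ε hε).and_eventually ha).exists
    exact hx2.trans hx1
  · intro b hb
    refine le_of_forall_pos_le_add fun ε hε => ?_
    have := hb (h1 ε hε)
    linarith

lemma asymp_aux (Ω : ℝ) (h0 : 0 < Ω) (b c : ℝ) (hb : 0 < b) (hc : 0 < c) (k : Fin 2 → ℤ) :
    |gammaK Ω k - |pairω Ω k| * |c * k 1 - b * Ω * k 0| * ((1 + Ω) / (c + b * Ω ^ 2))| ≤
      (1 + (1 + Ω) / (c + b * Ω ^ 2) * (b * Ω)) * |pairω Ω k| ^ 2 := by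
  have hD : 0 < c + b * Ω ^ 2 := by positivity
  have hE : 0 < (1 + Ω) / (c + b * Ω ^ 2) := by positivity
  have hED : (1 + Ω) / (c + b * Ω ^ 2) * (c + b * Ω ^ 2) = 1 + Ω := by field_simp
  rw [gammaK, norm1, pairω]
  push_cast
  generalize (k 0 : ℝ) = x
  generalize (k 1 : ℝ) = y
  generalize (1 + Ω) / (c + b * Ω ^ 2) = E at *
  obtain ⟨r, hr⟩ : ∃ r, r = x + y * Ω := ⟨_, rfl⟩
  have hx : x = r - y * Ω := by linarith
  rw [← hr]
  have e1 : c * y - b * Ω * x = (c + b * Ω ^ 2) * y - b * Ω * r := by rw [hx]; ring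
  have k1 : abs (|x| - |y| * Ω) ≤ |r| := by
    have := abs_abs_sub_abs_le_abs_sub x (-(y * Ω))
    rw [abs_neg, abs_mul, abs_of_pos h0] at this
    rw [hr]; simpa using this
  have k2 : abs (|c * y - b * Ω * x| - (c + b * Ω ^ 2) * |y|) ≤ b * Ω * |r| := by
    have := abs_abs_sub_abs_le_abs_sub (c * y - b * Ω * x) ((c + b * Ω ^ 2) * y)
    rw [abs_mul (c + b * Ω ^ 2), abs_of_pos hD] at this
    refine this.trans (le_of_eq ?_)
    rw [e1, show (c + b * Ω ^ 2) * y - b * Ω * r - (c + b * Ω ^ 2) * y = -(b * Ω * r) by ring,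
      abs_neg, abs_mul, abs_of_pos (mul_pos hb h0)]
  generalize |c * y - b * Ω * x| = Z at *
  have e2 : |r| * (|x| + |y|) - |r| * Z * E =
      |r| * ((|x| - |y| * Ω) - E * (Z - (c + b * Ω ^ 2) * |y|)) := by
    linear_combination -|r| * |y| * hED
  rw [e2, abs_mul, abs_abs]
  have k3 := abs_sub (|x| - |y| * Ω) (E * (Z - (c + b * Ω ^ 2) * |y|))
  rw [abs_mul E, abs_of_pos hE] at k3
  have k4 := mul_le_mul_of_nonneg_left k2 hE.le
  calc _ ≤ |r| * (|r| + E * (b * Ω * |r|)) :=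
        mul_le_mul_of_nonneg_left (by linarith) (abs_nonneg _)
    _ = _ := by ring

lemma descend (Ω lam : ℝ) (U : Matrix (Fin 2) (Fin 2) ℤ) (hU : IsUnit U.det)
    (hpair : ∀ k, lam * |pairω Ω (U.mulVec k)| = |pairω Ω k|)
    (G : (Fin 2 → ℤ) → ℤ) (hG : ∀ k, |G (U.mulVec k)| = |G k|) (n : ℕ) :
    ∀ k, inA Ω k → 1 / 2 ≤ lam ^ n * |pairω Ω k| →
      ∃ k', PrimitiveVec Ω U k' ∧ |G k'| = |G k| := by
  induction n with
  | zero =>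
    rintro k ⟨q, _, _, h⟩ h'
    simp at h'
    linarith
  | succ n ih =>
    intro k hk h
    by_cases hA : inA Ω (U⁻¹.mulVec k)
    · have hUk : U.mulVec (U⁻¹.mulVec k) = k := by
        rw [Matrix.mulVec_mulVec, Matrix.mul_nonsing_inv _ hU, Matrix.one_mulVec]
      have h2 := hpair (U⁻¹.mulVec k)
      have h3 := hG (U⁻¹.mulVec k)
      rw [hUk] at h2 h3
      obtain ⟨k', hk', hGk'⟩ := ih _ hA (by rw [← h2]; rw [pow_succ] at h; linarith)
      exact ⟨k', hk', hGk'.trans h3.symm⟩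
    · exact ⟨k, ⟨hk, hA⟩, rfl⟩

lemma exists_min_form (Ω : ℝ) (G : (Fin 2 → ℤ) → ℤ) {k₀ : Fin 2 → ℤ}
    (h : inA Ω k₀) : ∃ ks, inA Ω ks ∧ ∀ k, inA Ω k → |G ks| ≤ |G k| := by
  obtain ⟨ks, hks, hm⟩ := WellFounded.has_min (measure fun k => (G k).natAbs).wf
    {k | inA Ω k} ⟨k₀, h⟩
  refine ⟨ks, hks, fun k hk => ?_⟩
  have : ¬ (G k).natAbs < (G ks).natAbs := hm k hk
  rw [Int.abs_eq_natAbs, Int.abs_eq_natAbs]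
  omega

lemma Umat_eq (Ω : ℝ) (m : ℕ) (a b c d : ℤ) (hT : cfMatProd Ω m = !![a, b; c, d])
    (hdet : a * d - b * c = (-1) ^ m) : Umat Ω m = !![d, -c; -b, a] := by
  have hs : ((-1 : ℤ) ^ m) * (-1) ^ m = 1 := by rw [← mul_pow]; simp
  have hinv : (cfMatProd Ω m)⁻¹ = ((-1 : ℤ) ^ m) • !![d, -b; -c, a] := by
    apply Matrix.inv_eq_right_inv
    rw [hT, ← hdet] at *
    ext i k; fin_cases i <;> fin_cases k <;>
      simp [Matrix.mul_apply, Fin.sum_univ_two] <;> linarith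
  rw [Umat, hinv, Matrix.transpose_smul, smul_smul, hs, one_smul]
  ext i k; fin_cases i <;> fin_cases k <;> simp

lemma aux_periodic (Ω : ℝ) (h0 : 0 < Ω) (h1 : Ω < 1)
    (hquad : IsQuadraticIrrational Ω) (m : ℕ) (hm : 1 ≤ m) (hper : gaussOrbit Ω m = Ω) :
    ∃ qh : ℤ, PrimitiveInt Ω (Umat Ω m) qh ∧
        (∀ q : ℤ, PrimitiveInt Ω (Umat Ω m) q → gammaStarQ Ω m qh ≤ gammaStarQ Ω m q) ∧
        0 < gammaStarQ Ω m qh ∧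
        Filter.liminf (fun k : Fin 2 → ℤ => gammaK Ω k)
          (Filter.comap norm1 Filter.atTop) = gammaStarQ Ω m qh := by
  have hirr := hquad.1
  obtain ⟨γ, hγ, hdio⟩ := aux_dioph Ω hquad
  obtain ⟨a, b, c, d, hT, ha, -, -, -, -, hdet, hbc, heq⟩ := aux_mat Ω h0 h1 hirr m
  obtain ⟨hb, hc⟩ := hbc hm
  rw [hper] at heq
  have hU := Umat_eq Ω m a b c d hT hdet
  have haR : (1 : ℝ) ≤ a := by exact_mod_cast ha
  have hbR : (1 : ℝ) ≤ b := by exact_mod_cast hb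
  have hcR : (1 : ℝ) ≤ c := by exact_mod_cast hc
  have hb0 : (0 : ℝ) < b := by linarith
  have hc0 : (0 : ℝ) < c := by linarith
  have hpoly : (b : ℝ) * Ω ^ 2 + ((a - d : ℤ) : ℝ) * Ω + ((-c : ℤ) : ℝ) = 0 := by
    push_cast; linear_combination -heq
  obtain ⟨G, hGdef⟩ : ∃ G, G = qform b (a - d) (-c) := ⟨_, rfl⟩
  have hGge : ∀ k, k ≠ 0 → 1 ≤ |G k| := by
    intro k hk; rw [hGdef]
    exact qform_ge Ω hirr b (a - d) (-c) (by omega) hpoly k hk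
  have hGZ : ∀ k, |pairω Ω k| * |(c : ℝ) * k 1 - b * Ω * k 0| = Ω * ((|G k| : ℤ) : ℝ) := by
    intro k
    rw [← abs_mul, Int.cast_abs, ← abs_of_pos h0, ← abs_mul, abs_of_pos h0, hGdef,
      qform_fac Ω _ _ _ hpoly, ← abs_neg]
    congr 1
    push_cast
    linear_combination -pairω Ω k * k 1 * heq
  have hdetR : (a : ℝ) * d - b * c = (-1) ^ m := by exact_mod_cast hdet
  obtain ⟨lam, hlam⟩ : ∃ lam : ℝ, lam = a + b * Ω := ⟨_, rfl⟩
  have hlam1 : 1 < lam := by rw [hlam]; nlinarith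
  have hUmul : ∀ k, (Umat Ω m).mulVec k = ![d * k 0 - c * k 1, -b * k 0 + a * k 1] := by
    intro k
    rw [hU]
    ext i; fin_cases i <;> simp [Matrix.mulVec, dotProduct, Fin.sum_univ_two] <;> ring
  have hpair : ∀ k, lam * |pairω Ω ((Umat Ω m).mulVec k)| = |pairω Ω k| := by
    intro k
    have hl0 : 0 < lam := by linarith
    have : lam * pairω Ω ((Umat Ω m).mulVec k) = (-1) ^ m * pairω Ω k := by
      rw [← hdetR, hUmul, hlam]
      simp [pairω]
      linear_combination ((b : ℝ) * k 0 - a * k 1) * heq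
    calc _ = |lam * pairω Ω ((Umat Ω m).mulVec k)| := by rw [abs_mul, abs_of_pos hl0]
      _ = _ := by rw [this, abs_mul]; simp
  have hG : ∀ k, |G ((Umat Ω m).mulVec k)| = |G k| := by
    intro k
    have : G ((Umat Ω m).mulVec k) = (-1) ^ m * G k := by
      rw [← hdet, hUmul, hGdef]
      simp [qform]
      ring
    rw [this, abs_mul]; simp
  have hUdet : IsUnit (Umat Ω m).det := by
    rw [hU, Matrix.det_fin_two_of, Int.isUnit_iff]
    have : d * a - -c * -b = (-1) ^ m := by rw [← hdet]; ring
    rw [this]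
    exact neg_one_pow_eq_or ℤ m
  obtain ⟨E, hE⟩ : ∃ E, E = (1 + Ω) / ((c : ℝ) + b * Ω ^ 2) := ⟨_, rfl⟩
  have hE0 : 0 < E := by rw [hE]; positivity
  have hstar : ∀ q, gammaStarQ Ω m q = E * Ω * ((|G (kzero Ω q)| : ℤ) : ℝ) := by
    intro q
    rw [mul_assoc, ← hGZ, gammaStarQ, KqD, hT, hE]
    simp only [Matrix.of_apply, Matrix.cons_val', Matrix.cons_val_zero, Matrix.cons_val_one,
      Matrix.cons_val_fin_one, kzero, pairω]
    rw [abs_of_pos (show 0 < (c : ℝ) + b * Ω ^ 2 by positivity)]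
    push_cast
    rw [show (q : ℝ) * Ω - p0 Ω q = -p0 Ω q + q * Ω by ring,
      show (c : ℝ) * q - b * Ω * -p0 Ω q = c * q + b * p0 Ω q * Ω by ring]
    ring
  -- the minimum of `|G|` over quasi-resonances
  obtain ⟨ks, hks, hmin⟩ : ∃ ks, inA Ω ks ∧ ∀ k, inA Ω k → |G ks| ≤ |G k| := by
    obtain ⟨ks, hks, h⟩ := exists_min_form Ω G (inA_one Ω hirr)
    exact ⟨ks, hks, h⟩
  obtain ⟨kp, hkp, hGkp⟩ : ∃ k', PrimitiveVec Ω (Umat Ω m) k' ∧ |G k'| = |G ks| := by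
    have hpos : 0 < |pairω Ω ks| := abs_pos.mpr (pair_ne Ω hirr ks (inA_ne Ω ks hks))
    obtain ⟨n, hn⟩ := pow_unbounded_of_one_lt (1 / 2 / |pairω Ω ks|) hlam1
    rw [div_lt_iff₀ hpos] at hn
    exact descend Ω lam _ hUdet hpair G hG n ks hks hn.le
  have hkp' := hkp
  obtain ⟨⟨qh, hqh, rfl, -⟩, -⟩ := hkp'
  have hkne := inA_ne Ω _ hkp.1
  have hpos : 0 < gammaStarQ Ω m qh := by
    rw [hstar]
    have : (1 : ℝ) ≤ ((|G (kzero Ω qh)| : ℤ) : ℝ) := by exact_mod_cast hGge _ hkne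
    positivity
  refine ⟨qh, ⟨hqh, hkp⟩, ?_, hpos, ?_⟩
  · intro q hq
    rw [hstar, hstar, hGkp]
    have : ((|G ks| : ℤ) : ℝ) ≤ ((|G (kzero Ω q)| : ℤ) : ℝ) := by
      exact_mod_cast hmin _ hq.2.1
    exact mul_le_mul_of_nonneg_left this (by positivity)
  have hasym : ∃ M : ℝ, 0 < M ∧ ∀ k,
      |gammaK Ω k - E * Ω * ((|G k| : ℤ) : ℝ)| ≤ M * |pairω Ω k| ^ 2 := by
    refine ⟨1 + E * (b * Ω), by positivity, fun k => ?_⟩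
    have := asymp_aux Ω h0 b c hb0 hc0 k
    rw [hGZ, ← hE] at this
    rwa [show E * Ω * ((|G k| : ℤ) : ℝ) = Ω * ((|G k| : ℤ) : ℝ) * E by ring]
  obtain ⟨M, hM, hasym⟩ := hasym
  have hdelta : ∀ ε > 0, ∃ δ : ℝ, 0 < δ ∧ δ < 1 / 2 ∧
      ∀ k, |pairω Ω k| < δ → M * |pairω Ω k| ^ 2 ≤ ε := by
    intro ε hε
    have hεM : 0 < ε / M := by positivity
    refine ⟨min (1 / 4) (ε / M), lt_min (by norm_num) hεM,
      lt_of_le_of_lt (min_le_left _ _) (by norm_num), fun k hk => ?_⟩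
    have hk1 := hk.trans_le (min_le_left _ _)
    have hk2 := hk.trans_le (min_le_right _ _)
    have h3 : |pairω Ω k| ^ 2 ≤ ε / M := by nlinarith [abs_nonneg (pairω Ω k)]
    calc _ ≤ M * (ε / M) := mul_le_mul_of_nonneg_left h3 hM.le
      _ = ε := by field_simp
  have hbasis := (atTop_basis (α := ℤ)).comap norm1
  refine liminf_aux _ _ _ ?_ ?_
  · intro ε hε
    obtain ⟨δ, hδ, hδ2, hδ3⟩ := hdelta ε hε
    obtain ⟨N, hN⟩ := exists_nat_gt (gammaStarQ Ω m qh / δ)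
    rw [div_lt_iff₀ hδ] at hN
    rw [hbasis.eventually_iff]
    refine ⟨(N : ℤ) + 1, trivial, fun k hk => ?_⟩
    have hk : (N : ℤ) + 1 ≤ norm1 k := hk
    have hkR : (N : ℝ) + 1 ≤ norm1 k := by exact_mod_cast hk
    by_cases hr : |pairω Ω k| < δ
    · have hmin' : |G (kzero Ω qh)| ≤ |G k| := by
        rw [hGkp]
        rcases lt_trichotomy (k 1) 0 with h | h | h
        · have hneg : |pairω Ω (-k)| = |pairω Ω k| := by
            rw [← abs_neg]; congr 1; simp [pairω]; ring
          have h3 : G (-k) = G k := by rw [hGdef]; simp [qform]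
          rw [← h3]
          refine hmin _ (inA_of Ω _ ?_ ?_)
          · simp only [Pi.neg_apply]; omega
          · rw [hneg]; linarith
        · exfalso
          have h4 : |(k 0 : ℝ)| < 1 := by
            have : |pairω Ω k| < 1 := by linarith
            simpa [pairω, h] using this
          have h5 : |k 0| < 1 := by exact_mod_cast h4
          rw [norm1, h, abs_zero] at hk
          omega
        · exact hmin _ (inA_of Ω _ (by omega) (by linarith))
      have hminR : ((|G (kzero Ω qh)| : ℤ) : ℝ) ≤ ((|G k| : ℤ) : ℝ) := by exact_mod_cast hmin'
      have h5 := mul_le_mul_of_nonneg_left hminR (show 0 ≤ E * Ω by positivity)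
      have h6 := (abs_le.mp (hasym k)).1
      have h7 := hδ3 k hr
      rw [hstar]
      linarith
    · push Not at hr
      have : δ * ((N : ℝ) + 1) ≤ gammaK Ω k := by
        rw [gammaK]
        exact mul_le_mul hr hkR (by positivity) (abs_nonneg _)
      nlinarith
  · intro ε hε
    obtain ⟨δ, hδ, hδ2, hδ3⟩ := hdelta ε hε
    rw [hbasis.frequently_iff]
    intro N _
    have hiter : ∀ n : ℕ, ∃ k, |G k| = |G (kzero Ω qh)| ∧
        lam ^ n * |pairω Ω k| = |pairω Ω (kzero Ω qh)| := by
      intro n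
      induction n with
      | zero => exact ⟨kzero Ω qh, rfl, by simp⟩
      | succ n ih =>
        obtain ⟨k, hk1, hk2⟩ := ih
        refine ⟨(Umat Ω m).mulVec k, (hG k).trans hk1, ?_⟩
        rw [pow_succ, mul_assoc, hpair, hk2]
    have hr0 : 0 < |pairω Ω (kzero Ω qh)| := abs_pos.mpr (pair_ne Ω hirr _ hkne)
    obtain ⟨η, hη, hηδ, hηN⟩ : ∃ η : ℝ, 0 < η ∧ η ≤ δ ∧ η * N ≤ γ := by
      have hden : 0 < |(N : ℝ)| + 1 := by positivity
      refine ⟨min δ (γ / (|(N : ℝ)| + 1)), lt_min hδ (by positivity), min_le_left _ _, ?_⟩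
      have h3 : min δ (γ / (|(N : ℝ)| + 1)) * (|(N : ℝ)| + 1) ≤ γ := by
        rw [← le_div_iff₀ hden]; exact min_le_right _ _
      refine le_trans (mul_le_mul_of_nonneg_left ?_ (lt_min hδ (by positivity)).le) h3
      linarith [le_abs_self (N : ℝ)]
    obtain ⟨n, hn⟩ := pow_unbounded_of_one_lt (|pairω Ω (kzero Ω qh)| / η) hlam1
    rw [div_lt_iff₀ hη] at hn
    obtain ⟨k, hk1, hk2⟩ := hiter n
    have hln : 0 < lam ^ n := pow_pos (by linarith) n
    have hrη : |pairω Ω k| < η := by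
      rw [← hk2] at hn
      exact lt_of_mul_lt_mul_left hn hln.le
    have hkne' : k ≠ 0 := by
      rintro rfl
      rw [← hk2] at hr0
      simp [pairω] at hr0
    refine ⟨k, ?_, ?_⟩
    · have hnp : (0 : ℝ) < norm1 k := by exact_mod_cast norm1_pos k hkne'
      have h3 := hdio k hkne'
      rw [div_le_iff₀ hnp] at h3
      have h4 : η * N < η * norm1 k := by nlinarith
      have h5 := lt_of_mul_lt_mul_left h4 hη.le
      have h6 : N < norm1 k := by exact_mod_cast h5
      exact h6.le
    · have h6 := (abs_le.mp (hasym k)).2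
      have h7 := hδ3 k (hrη.trans_le hηδ)
      rw [hk1, ← hstar] at h6
      show gammaK Ω k ≤ _
      linarith

/-- Diophantine property of vectors with quadratic ratio: `ω = (1, Ω)` satisfies
`|⟨k,ω⟩| ≥ γ/|k|₁` for all `k ≠ 0`, with some `γ > 0`; moreover, when the continued
fraction of `Ω` is purely periodic, the liminf of `γ_k` as `|k|₁ → ∞` equals
`γ* = min over primitive q of γ*_q`, which is positive. -/
theorem splitting_quadratic_stmt9
    (Ω : ℝ) (h0 : 0 < Ω) (h1 : Ω < 1)
    (hquad : IsQuadraticIrrational Ω) :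
    (∃ γ : ℝ, 0 < γ ∧ ∀ k : Fin 2 → ℤ, k ≠ 0 → γ / (norm1 k : ℝ) ≤ |pairω Ω k|) ∧
    (∀ m : ℕ, 1 ≤ m → gaussOrbit Ω m = Ω →
      ∃ qh : ℤ, PrimitiveInt Ω (Umat Ω m) qh ∧
        (∀ q : ℤ, PrimitiveInt Ω (Umat Ω m) q → gammaStarQ Ω m qh ≤ gammaStarQ Ω m q) ∧
        0 < gammaStarQ Ω m qh ∧
        Filter.liminf (fun k : Fin 2 → ℤ => gammaK Ω k)
          (Filter.comap norm1 Filter.atTop) = gammaStarQ Ω m qh) := by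
  exact ⟨aux_dioph Ω hquad, fun m hm hper => aux_periodic Ω h0 h1 hquad m hm hper⟩
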